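/- arXiv:quant-ph/0503013 — 2 statements merged into one kernel-verified Lean document; each statement's English description precedes it below -/
import Mathlib

section
/- Let Sp(D, n) = {M ∈ M_{2n×2n}(Z/DZ) : M^T Ω M = Ω} with Ω = [[0, I], [−I, 0]]. Then #Sp(D, n) = D^{n²} · ∏_{k=1}^{n} φ_{2k}(D), where φ_m(D) = D^m ∏_{p prime, p∣D}(p^m − 1)/p^m for D ≥ 2. -/
open Matrix

/-- Generalized Euler totient: the number of vectors in `(ZMod D)^m` whose
components (as integer representatives) together with `D` have gcd 1. -/
noncomputable def phiN (m D : ℕ) : ℕ :=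
  Nat.card {v : Fin m → ZMod D //
    Nat.gcd (Finset.univ.gcd fun i => (v i).val) D = 1}

section Helpers

variable {R : Type*} [CommRing R] {V : Type*} [AddCommGroup V] [Module R V]
  {W : Type*} [AddCommGroup W] [Module R W]

/-- Isometry group of a bilinear form. -/
def IsoG (B : V →ₗ[R] V →ₗ[R] R) : Subgroup (V ≃ₗ[R] V) where
  carrier := {g | ∀ x y, B (g x) (g y) = B x y}
  mul_mem' := by
    intro a b ha hb x y
    simp only [LinearEquiv.mul_apply]
    rw [ha, hb]
  one_mem' := by intro x y; rfl
  inv_mem' := by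
    intro a ha x y
    have := ha (a⁻¹ x) (a⁻¹ y)
    rw [← this]
    simp [← LinearEquiv.mul_apply]

theorem mem_IsoG {B : V →ₗ[R] V →ₗ[R] R} {g : V ≃ₗ[R] V} :
    g ∈ IsoG B ↔ ∀ x y, B (g x) (g y) = B x y := Iff.rfl

theorem alt_neg {B : V →ₗ[R] V →ₗ[R] R} (hB : ∀ x, B x x = 0) (x y : V) : B x y = - B y x := by
  have := hB (x + y)
  simp only [map_add, LinearMap.add_apply, hB] at this
  linear_combination this

theorem exists_transvection {B : V →ₗ[R] V →ₗ[R] R} (hB : ∀ x, B x x = 0) (v w : V)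
    (h : IsUnit (B v w)) : ∃ g ∈ IsoG B, g v = w := by
  obtain ⟨c, hc⟩ := h.exists_left_inv
  have key : ∀ (d : R) (u x y : V), B (x + d • B u x • u) (y + d • B u y • u) = B x y := by
    intro d u x y
    simp only [map_add, LinearMap.add_apply, map_smul, LinearMap.smul_apply, smul_eq_mul, hB]
    rw [alt_neg hB x u]; ring
  have inv : ∀ (d : R) (u x : V),
      (x + d • B u x • u) + (-d) • B u (x + d • B u x • u) • u = x := by
    intro d u x
    simp only [map_add, map_smul, smul_eq_mul, hB]
    module
  let T : R → V → (V →ₗ[R] V) := fun d u => LinearMap.id + d • (B u).smulRight u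
  have hT : ∀ d u x, T d u x = x + d • B u x • u := by intro d u x; simp [T]
  refine ⟨LinearEquiv.ofLinearMap (T (-c) (w - v)) (T c (w - v)) ?_ ?_, ?_, ?_⟩
  · ext x
    simp only [LinearMap.comp_apply, hT, LinearMap.id_apply]
    exact inv _ _ _
  · ext x
    simp only [LinearMap.comp_apply, hT, LinearMap.id_apply]
    have := inv (-c) (w - v) x
    rwa [neg_neg] at this
  · intro x y
    simp only [LinearEquiv.coe_ofLinearMap, hT]
    exact key _ _ _ _
  · simp only [LinearEquiv.coe_ofLinearMap, hT]
    have : B (w - v) v = - B v w := by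
      simp [hB, alt_neg hB w v]
    rw [this, smul_smul, neg_mul_neg, hc]
    simp

theorem exists_eichler {B : V →ₗ[R] V →ₗ[R] R} (hB : ∀ x, B x x = 0) (e w w' : V)
    (h : B e w = 1) (h' : B e w' = 1) : ∃ g ∈ IsoG B, g e = e ∧ g w = w' := by
  let T : R → V → (V →ₗ[R] V) := fun c u =>
    LinearMap.id + (B e).smulRight u + (B u).smulRight e + c • (B e).smulRight e
  have hT : ∀ c u x, T c u x = x + B e x • u + B u x • e + c • B e x • e := by
    intro c u x; simp [T]
  have inv : ∀ c u, B e u = 0 → ∀ x, T (-c) (-u) (T c u x) = x := by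
    intro c u hu x
    have hu' : B u e = 0 := by rw [alt_neg hB, hu, neg_zero]
    simp only [hT, map_add, map_smul, smul_eq_mul, hB, hu, hu', map_neg, LinearMap.neg_apply]
    module
  have key : ∀ c u, B e u = 0 → ∀ x y, B (T c u x) (T c u y) = B x y := by
    intro c u hu x y
    have hu' : B u e = 0 := by rw [alt_neg hB, hu, neg_zero]
    simp only [hT, map_add, LinearMap.add_apply, map_smul, LinearMap.smul_apply, smul_eq_mul, hB,
      hu, hu']
    rw [alt_neg hB x u, alt_neg hB x e]; ring
  have hu : B e (w' - w) = 0 := by simp [h, h']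
  refine ⟨LinearEquiv.ofLinearMap (T (-B (w' - w) w) (w' - w)) (T (B (w' - w) w) (-(w' - w)))
    ?_ ?_, ?_, ?_, ?_⟩
  · ext x
    have := inv (B (w' - w) w) (-(w' - w)) (by rw [map_neg, hu, neg_zero]) x
    rw [neg_neg] at this
    exact this
  · ext x
    have := inv (-B (w' - w) w) (w' - w) hu x
    rw [neg_neg] at this
    exact this
  · intro x y
    exact key _ _ hu x y
  · have hu' : B (w' - w) e = 0 := by rw [alt_neg hB, hu, neg_zero]
    rw [LinearEquiv.coe_ofLinearMap, hT, hB, hu']; simp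
  · rw [LinearEquiv.coe_ofLinearMap, hT, h]
    module

/-- Ring condition used for transitivity. -/
def RCond (R : Type*) [CommRing R] : Prop :=
  ∀ a b : R, ∃ s t : R, IsUnit (s + t * a) ∧ IsUnit (s * b + t)

theorem exists_trans {B : V →ₗ[R] V →ₗ[R] R} (hB : ∀ x, B x x = 0) (hR : RCond R)
    (e f v w : V) (h : B e f = 1) (h' : B v w = 1) : ∃ g ∈ IsoG B, g e = v ∧ g f = w := by
  obtain ⟨s, t, hs, ht⟩ := hR (B e w) (B v f)
  obtain ⟨g₁, hg₁, h₁⟩ := exists_transvection hB e (s • f + t • w) (by simpa [h] using hs)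
  obtain ⟨g₂, hg₂, h₂⟩ := exists_transvection hB (s • f + t • w) v (by
    rw [alt_neg hB]; simpa [h', add_comm] using ht.neg)
  have hg := (IsoG B).mul_mem hg₂ hg₁
  obtain ⟨g₃, hg₃, h₃, h₄⟩ := exists_eichler hB v ((g₂ * g₁) f) w (by
    rw [← h, ← hg e f]; simp [h₁, h₂]) h'
  refine ⟨g₃ * (g₂ * g₁), (IsoG B).mul_mem hg₃ hg, ?_, ?_⟩
  · simp [h₁, h₂, h₃]
  · simpa using h₄

theorem card_IsoG_eq {B : V →ₗ[R] V →ₗ[R] R} (hB : ∀ x, B x x = 0) (hR : RCond R)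
    (e f : V) (h : B e f = 1) :
    Nat.card (IsoG B) = Nat.card {p : V × V // B p.1 p.2 = 1} *
      Nat.card {g : IsoG B // g.1 e = e ∧ g.1 f = f} := by
  have hs : ∀ p : {p : V × V // B p.1 p.2 = 1}, ∃ g : IsoG B, g.1 e = p.1.1 ∧ g.1 f = p.1.2 := by
    rintro ⟨⟨v, w⟩, hp⟩
    obtain ⟨g, hg, h1⟩ := exists_trans hB hR e f v w h hp
    exact ⟨⟨g, hg⟩, h1⟩
  choose s hs1 hs2 using hs
  rw [← Nat.card_prod]
  refine Nat.card_congr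
    { toFun := fun g =>
        let p : {p : V × V // B p.1 p.2 = 1} := ⟨(g.1 e, g.1 f), by rw [← h]; exact g.2 e f⟩
        (p, ⟨(s p)⁻¹ * g, ?_, ?_⟩)
      invFun := fun q => s q.1 * q.2.1
      left_inv := ?_
      right_inv := ?_ }
  · have := hs1 p
    change (s p).1⁻¹ (g.1 e) = e
    rw [show g.1 e = (s p).1 e from this.symm, ← LinearEquiv.mul_apply]; simp
  · have := hs2 p
    change (s p).1⁻¹ (g.1 f) = f
    rw [show g.1 f = (s p).1 f from this.symm, ← LinearEquiv.mul_apply]; simp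
  · intro g; simp
  · rintro ⟨p, g, hg1, hg2⟩
    have hp : (⟨((s p * g).1 e, (s p * g).1 f), by rw [← h]; exact (s p * g).2 e f⟩ :
        {p : V × V // B p.1 p.2 = 1}) = p := by
      apply Subtype.ext
      apply Prod.ext
      · change (s p).1 (g.1 e) = _
        rw [hg1, hs1]
      · change (s p).1 (g.1 f) = _
        rw [hg2, hs2]
    refine Prod.ext hp (Subtype.ext ?_)
    change (s _)⁻¹ * (s p * g) = g
    rw [hp]; simp

theorem card_fiber [Finite V] [Finite R] (B : V →ₗ[R] V →ₗ[R] R) (v w₀ : V) (h : B v w₀ = 1) :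
    Nat.card {w : V // B v w = 1} * Nat.card R = Nat.card V := by
  rw [← Nat.card_prod]
  refine Nat.card_congr
    { toFun := fun q => q.1.1 + (q.2 - 1) • w₀
      invFun := fun x => (⟨x + (1 - B v x) • w₀, by simp [h]⟩, B v x)
      left_inv := ?_
      right_inv := ?_ }
  · rintro ⟨⟨w, hw⟩, r⟩
    refine Prod.ext (Subtype.ext ?_) ?_
    · simp [h, hw]
      module
    · simp [h, hw]
  · intro x
    simp only
    module

theorem card_pairs [Finite V] [Finite R] (B : V →ₗ[R] V →ₗ[R] R) :
    Nat.card {p : V × V // B p.1 p.2 = 1} * Nat.card R =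
      Nat.card {v : V // ∃ w, B v w = 1} * Nat.card V := by
  have e : {p : V × V // B p.1 p.2 = 1} ≃
      Σ v : {v : V // ∃ w, B v w = 1}, {w : V // B v.1 w = 1} :=
    { toFun := fun p => ⟨⟨p.1.1, p.1.2, p.2⟩, ⟨p.1.2, p.2⟩⟩
      invFun := fun q => ⟨(q.1.1, q.2.1), q.2.2⟩
      left_inv := fun _ => rfl
      right_inv := fun _ => rfl }
  have := Fintype.ofFinite {v : V // ∃ w, B v w = 1}
  rw [Nat.card_congr e, Nat.card_sigma, Finset.sum_mul,
    Finset.sum_congr rfl (fun v _ => card_fiber B v.1 v.2.choose v.2.choose_spec)]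
  simp [Nat.card_eq_fintype_card]

/-- Hyperbolic extension of a form. -/
def hyp (B : W →ₗ[R] W →ₗ[R] R) : ((R × R) × W) →ₗ[R] ((R × R) × W) →ₗ[R] R :=
  LinearMap.mk₂ R (fun x y => x.1.1 * y.1.2 - x.1.2 * y.1.1 + B x.2 y.2)
    (by intros; simp; ring) (by intros; simp; ring) (by intros; simp; ring)
    (by intros; simp; ring)

theorem hyp_apply (B : W →ₗ[R] W →ₗ[R] R) (x y) :
    hyp B x y = x.1.1 * y.1.2 - x.1.2 * y.1.1 + B x.2 y.2 := rfl

theorem stab_form {B : W →ₗ[R] W →ₗ[R] R} (g : ((R × R) × W) ≃ₗ[R] ((R × R) × W))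
    (hg : g ∈ IsoG (hyp B)) (h1 : g ((1, 0), 0) = ((1, 0), 0)) (h2 : g ((0, 1), 0) = ((0, 1), 0)) :
    ∀ x, (g x).1 = x.1 := by
  intro x
  have a := hg ((1, 0), 0) x
  have b := hg ((0, 1), 0) x
  rw [h1] at a
  rw [h2] at b
  simp [hyp_apply] at a b
  exact Prod.ext b a

theorem stab_form2 {B : W →ₗ[R] W →ₗ[R] R} (g : ((R × R) × W) ≃ₗ[R] ((R × R) × W))
    (hg : g ∈ IsoG (hyp B)) (h1 : g ((1, 0), 0) = ((1, 0), 0)) (h2 : g ((0, 1), 0) = ((0, 1), 0)) :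
    ∀ x, g x = (x.1, (g (0, x.2)).2) := by
  rintro ⟨⟨a, b⟩, w⟩
  have : (((a, b), w) : (R × R) × W) = a • ((1, 0), 0) + b • ((0, 1), 0) + (0, w) := by
    simp
  have h0 := stab_form g hg h1 h2 (0, w)
  rw [this, map_add, map_add, map_smul, map_smul, h1, h2]
  refine Prod.ext ?_ ?_
  · simp [h0]
  · simp

theorem card_stab (B : W →ₗ[R] W →ₗ[R] R) :
    Nat.card {g : IsoG (hyp B) // g.1 ((1, 0), 0) = ((1, 0), 0) ∧ g.1 ((0, 1), 0) = ((0, 1), 0)} =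
      Nat.card (IsoG B) := by
  symm
  let F : IsoG B → {g : IsoG (hyp B) //
      g.1 ((1, 0), 0) = ((1, 0), 0) ∧ g.1 ((0, 1), 0) = ((0, 1), 0)} := fun g =>
    ⟨⟨(LinearEquiv.refl R (R × R)).prodCongr g.1, by
      intro x y
      simp [hyp_apply, g.2 x.2 y.2]⟩, by simp, by simp⟩
  refine Nat.card_congr (Equiv.ofBijective F ⟨?_, ?_⟩)
  · intro g g' h
    apply Subtype.ext
    ext w
    have := congrArg (fun k => (k.1.1 (0, w)).2) h
    simpa [F] using this
  · rintro ⟨⟨g, hg⟩, h1, h2⟩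
    have hgi := (IsoG (hyp B)).inv_mem hg
    have h1i : g⁻¹ ((1, 0), 0) = ((1, 0), 0) := by
      conv_lhs => rw [← h1]
      simp [← LinearEquiv.mul_apply]
    have h2i : g⁻¹ ((0, 1), 0) = ((0, 1), 0) := by
      conv_lhs => rw [← h2]
      simp [← LinearEquiv.mul_apply]
    have k := stab_form2 g hg h1 h2
    have ki := stab_form2 g⁻¹ hgi h1i h2i
    let T : (((R × R) × W) ≃ₗ[R] ((R × R) × W)) → (W →ₗ[R] W) := fun g =>
      LinearMap.snd R (R × R) W ∘ₗ g.toLinearMap ∘ₗ LinearMap.inr R (R × R) W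
    have hT : ∀ g w, T g w = (g (0, w)).2 := fun _ _ => rfl
    refine ⟨⟨LinearEquiv.ofLinearMap (T g) (T g⁻¹) ?_ ?_, ?_⟩, ?_⟩
    · ext w
      have a : g (g⁻¹ (0, w)) = (0, w) := by simp [← LinearEquiv.mul_apply]
      rw [ki] at a
      exact congrArg Prod.snd a
    · ext w
      have a : g⁻¹ (g (0, w)) = (0, w) := by simp [← LinearEquiv.mul_apply]
      rw [k] at a
      exact congrArg Prod.snd a
    · intro x y
      have := hg (0, x) (0, y)
      rw [k (0, x), k (0, y)] at this
      simpa [hyp_apply, hT] using this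
    · apply Subtype.ext
      apply Subtype.ext
      apply LinearEquiv.ext
      intro x
      rw [k x]
      rfl

theorem card_IsoG_congr {B : V →ₗ[R] V →ₗ[R] R} {C : W →ₗ[R] W →ₗ[R] R} (φ : V ≃ₗ[R] W)
    (h : ∀ x y, C (φ x) (φ y) = B x y) : Nat.card (IsoG B) = Nat.card (IsoG C) := by
  have h' : ∀ x y, B (φ.symm x) (φ.symm y) = C x y := by intro x y; rw [← h]; simp
  refine Nat.card_congr
    { toFun := fun g => ⟨(φ.symm.trans g.1).trans φ, ?_⟩
      invFun := fun g => ⟨(φ.trans g.1).trans φ.symm, ?_⟩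
      left_inv := ?_
      right_inv := ?_ }
  · intro x y
    simp [h, g.2 (φ.symm x) (φ.symm y), h']
  · intro x y
    simp [h, g.2 (φ x) (φ y), h']
  · intro g; apply Subtype.ext; ext x; simp
  · intro g; apply Subtype.ext; ext x; simp

theorem card_hyp [Finite W] [Finite R] {B : W →ₗ[R] W →ₗ[R] R} (hB : ∀ x, B x x = 0)
    (hR : RCond R) :
    Nat.card (IsoG (hyp B)) * Nat.card R =
      Nat.card {v // ∃ w, hyp B v w = 1} * (Nat.card R * Nat.card R * Nat.card W) *
        Nat.card (IsoG B) := by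
  have hH : ∀ x, hyp B x x = 0 := by intro x; rw [hyp_apply, hB]; ring
  rw [card_IsoG_eq hH hR ((1, 0), 0) ((0, 1), 0) (by simp [hyp_apply]), card_stab,
    mul_right_comm, card_pairs, Nat.card_prod, Nat.card_prod]

end Helpers

section Concrete

/-- The standard form on `(Fin n ⊕ Fin n → R)`. -/
noncomputable def stdB (R : Type*) [CommRing R] (n : ℕ) :
    (Fin n ⊕ Fin n → R) →ₗ[R] (Fin n ⊕ Fin n → R) →ₗ[R] R :=
  Matrix.toLinearMap₂' R (Matrix.fromBlocks 0 1 (-1) 0)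

variable {R : Type*} [CommRing R]

theorem stdB_apply' (n : ℕ) (x y : Fin n ⊕ Fin n → R) :
    stdB R n x y = x ⬝ᵥ (Matrix.fromBlocks 0 1 (-1) 0 : Matrix _ _ R) *ᵥ y := by
  rw [stdB, Matrix.toLinearMap₂'_apply']

theorem stdB_apply (n : ℕ) (x y : Fin n ⊕ Fin n → R) :
    stdB R n x y = ∑ i, (x (.inl i) * y (.inr i) - x (.inr i) * y (.inl i)) := by
  rw [stdB_apply', Matrix.fromBlocks_mulVec]
  simp [dotProduct, Fintype.sum_sum_type, Matrix.neg_mulVec, sub_eq_add_neg,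
    Finset.sum_add_distrib]

theorem stdB_alt (n : ℕ) (x : Fin n ⊕ Fin n → R) : stdB R n x x = 0 := by
  rw [stdB_apply]
  exact Finset.sum_eq_zero (fun i _ => by ring)

/-- Split off a hyperbolic plane. -/
def splitE (R : Type*) [CommRing R] (n : ℕ) :
    (Fin (n + 1) ⊕ Fin (n + 1) → R) ≃ₗ[R] (R × R) × (Fin n ⊕ Fin n → R) where
  toFun x := ((x (.inl 0), x (.inr 0)), Sum.elim (fun i => x (.inl i.succ)) (fun i => x (.inr i.succ)))
  invFun y := Sum.elim (Fin.cons y.1.1 fun i => y.2 (.inl i)) (Fin.cons y.1.2 fun i => y.2 (.inr i))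
  map_add' := by
    intro x y
    refine Prod.ext rfl ?_
    ext (i | i) <;> rfl
  map_smul' := by
    intro c y
    refine Prod.ext rfl ?_
    ext (i | i) <;> rfl
  left_inv := by
    intro x
    ext (i | i) <;> refine Fin.cases ?_ (fun j => ?_) i <;> simp
  right_inv := by
    intro x
    refine Prod.ext rfl ?_
    ext (i | i) <;> rfl

theorem splitE_form (n : ℕ) (x y : Fin (n + 1) ⊕ Fin (n + 1) → R) :
    hyp (stdB R n) (splitE R n x) (splitE R n y) = stdB R (n + 1) x y := by
  rw [hyp_apply, stdB_apply, stdB_apply, Fin.sum_univ_succ]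
  rfl

theorem card_step [Finite R] (hR : RCond R) (n : ℕ) :
    Nat.card (IsoG (stdB R (n + 1))) * Nat.card R =
      Nat.card {v // ∃ w, stdB R (n + 1) v w = 1} * Nat.card R ^ (2 * n + 2) *
        Nat.card (IsoG (stdB R n)) := by
  rw [card_IsoG_congr (splitE R n) (splitE_form n), card_hyp (stdB_alt n) hR]
  have h1 : Nat.card {v // ∃ w, stdB R (n + 1) v w = 1} =
      Nat.card {v // ∃ w, hyp (stdB R n) v w = 1} := by
    refine Nat.card_congr ((splitE R n).toEquiv.subtypeEquiv fun v => ?_)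
    constructor
    · rintro ⟨w, hw⟩
      exact ⟨splitE R n w, by rw [← hw]; exact splitE_form n v w⟩
    · rintro ⟨w, hw⟩
      refine ⟨(splitE R n).symm w, ?_⟩
      rw [← splitE_form]; simpa using hw
  rw [h1]
  have h2 : Nat.card (Fin n ⊕ Fin n → R) = Nat.card R ^ (2 * n) := by
    rw [Nat.card_fun]; simp [two_mul]
  rw [h2]
  ring

theorem card_matrix (n : ℕ) :
    Nat.card {M : Matrix (Fin n ⊕ Fin n) (Fin n ⊕ Fin n) R //
        Mᵀ * Matrix.fromBlocks 0 1 (-1) 0 * M = Matrix.fromBlocks 0 1 (-1) 0} =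
      Nat.card (IsoG (stdB R n)) := by
  symm
  have key : ∀ M : Matrix (Fin n ⊕ Fin n) (Fin n ⊕ Fin n) R,
      (∀ x y, stdB R n (M *ᵥ x) (M *ᵥ y) = stdB R n x y) ↔
      Mᵀ * Matrix.fromBlocks 0 1 (-1) 0 * M = Matrix.fromBlocks 0 1 (-1) 0 := by
    intro M
    have h : ∀ x y, stdB R n (M *ᵥ x) (M *ᵥ y) =
        Matrix.toLinearMap₂' R (Mᵀ * Matrix.fromBlocks 0 1 (-1) 0 * M) x y := by
      intro x y
      rw [stdB_apply', Matrix.toLinearMap₂'_apply', ← Matrix.mulVec_mulVec, ← Matrix.mulVec_mulVec,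
        Matrix.dotProduct_mulVec x, Matrix.vecMul_transpose]
    constructor
    · intro hM
      apply (Matrix.toLinearMap₂' R (n := Fin n ⊕ Fin n) (m := Fin n ⊕ Fin n) (S₁ := R) (S₂ := R) (N₂ := R)).injective
      apply LinearMap.ext₂
      intro x y
      rw [← h, hM]; rfl
    · intro hM x y
      rw [h, hM]; rfl
  let F : IsoG (stdB R n) → {M : Matrix (Fin n ⊕ Fin n) (Fin n ⊕ Fin n) R //
        Mᵀ * Matrix.fromBlocks 0 1 (-1) 0 * M = Matrix.fromBlocks 0 1 (-1) 0} := fun g =>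
    ⟨LinearMap.toMatrix' g.1.toLinearMap, by
      rw [← key]
      intro x y
      have := g.2 x y
      rw [LinearMap.toMatrix'_mulVec, LinearMap.toMatrix'_mulVec]
      exact this⟩
  refine Nat.card_congr (Equiv.ofBijective F ⟨?_, ?_⟩)
  · intro g g' h
    apply Subtype.ext
    apply LinearEquiv.toLinearMap_injective
    exact LinearMap.toMatrix'.injective (congrArg Subtype.val h)
  · rintro ⟨M, hM⟩
    have hinv : (-(Matrix.fromBlocks 0 1 (-1) 0 * Mᵀ * Matrix.fromBlocks 0 1 (-1) 0)) * M = 1 := by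
      rw [Matrix.neg_mul, Matrix.mul_assoc, Matrix.mul_assoc, ← Matrix.mul_assoc Mᵀ, hM,
        Matrix.fromBlocks_multiply]
      simp [Matrix.fromBlocks_neg]
    have hinv' := mul_eq_one_comm.mp hinv
    refine ⟨⟨LinearEquiv.ofLinearMap (Matrix.toLin' M)
      (Matrix.toLin' (-(Matrix.fromBlocks 0 1 (-1) 0 * Mᵀ * Matrix.fromBlocks 0 1 (-1) 0)))
      ?_ ?_, ?_⟩, ?_⟩
    · rw [← Matrix.toLin'_mul, hinv', Matrix.toLin'_one]
    · rw [← Matrix.toLin'_mul, hinv, Matrix.toLin'_one]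
    · intro x y
      simpa using (key M).mpr hM x y
    · apply Subtype.ext
      change LinearMap.toMatrix' (Matrix.toLin' M) = M
      simp

end Concrete

section ZModPart

theorem zmod_isUnit (D : ℕ) [NeZero D] (x : ZMod D)
    (h : ∀ p : ℕ, p.Prime → ∀ hp : p ∣ D, ZMod.castHom hp (ZMod p) x ≠ 0) : IsUnit x := by
  rw [← ZMod.natCast_zmod_val x, ZMod.isUnit_iff_coprime]
  refine Nat.Coprime.symm (Nat.Coprime.symm (Nat.coprime_of_dvd ?_))
  intro p hp h1 h2
  apply h p hp h2
  rw [← ZMod.natCast_zmod_val x, map_natCast]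
  exact (ZMod.natCast_eq_zero_iff _ _).mpr h1

theorem zmod_rcond (D : ℕ) [NeZero D] : RCond (ZMod D) := by
  intro a b
  have hN : ∀ p : ℕ, p.Prime → ∀ hp : p ∣ D, ∀ x : ZMod p, x ≠ 0 → x ^ (Nat.totient D) = 1 := by
    intro p hp hpD x hx
    have : Fact p.Prime := ⟨hp⟩
    obtain ⟨k, hk⟩ := Nat.totient_dvd_of_dvd hpD
    rw [hk, Nat.totient_prime hp, pow_mul, ZMod.pow_card_sub_one_eq_one hx, one_pow]
  have hN0 : Nat.totient D ≠ 0 := (Nat.totient_pos.mpr (NeZero.pos D)).ne'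
  refine ⟨1 - (1 - b ^ (Nat.totient D)) * a ^ (Nat.totient D), 1 - b ^ (Nat.totient D), ?_, ?_⟩
  all_goals
    apply zmod_isUnit
    intro p hp hpD
    have : Fact p.Prime := ⟨hp⟩
    simp only [map_add, map_sub, map_mul, map_pow, map_one]
    generalize ZMod.castHom hpD (ZMod p) a = a'
    generalize ZMod.castHom hpD (ZMod p) b = b'
    by_cases ha : a' = 0 <;> by_cases hb : b' = 0 <;>
      simp [ha, hb, hN0, hN p hp hpD]

theorem zmod_bezout (D : ℕ) [NeZero D] {ι : Type*} [DecidableEq ι] (s : Finset ι) (v : ι → ZMod D) :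
    ∃ c : ι → ZMod D, ∑ i ∈ s, c i * v i = ((s.gcd fun i => (v i).val : ℕ) : ZMod D) := by
  induction s using Finset.induction_on with
  | empty => exact ⟨0, by simp⟩
  | insert a s ha ih =>
    obtain ⟨c, hc⟩ := ih
    set g := s.gcd fun i => (v i).val with hg
    refine ⟨fun i => if i = a then ((Nat.gcdA (v a).val g : ℤ) : ZMod D) else
      c i * ((Nat.gcdB (v a).val g : ℤ) : ZMod D), ?_⟩
    rw [Finset.sum_insert ha, Finset.gcd_insert, ← hg]
    have h1 : ∑ i ∈ s, (if i = a then ((Nat.gcdA (v a).val g : ℤ) : ZMod D) else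
      c i * ((Nat.gcdB (v a).val g : ℤ) : ZMod D)) * v i =
        (∑ i ∈ s, c i * v i) * ((Nat.gcdB (v a).val g : ℤ) : ZMod D) := by
      rw [Finset.sum_mul]
      refine Finset.sum_congr rfl fun i hi => ?_
      rw [if_neg (by rintro rfl; exact ha hi)]; ring
    rw [h1, hc]
    simp only [if_true]
    have h2 := congrArg (Int.cast : ℤ → ZMod D) (Nat.gcd_eq_gcd_ab (v a).val g)
    push_cast at h2
    rw [ZMod.natCast_zmod_val] at h2
    change _ = ((Nat.gcd (v a).val g : ℕ) : ZMod D)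
    rw [h2]; ring

theorem zmod_unimod (D : ℕ) [NeZero D] {ι : Type*} [Fintype ι] (v : ι → ZMod D) :
    Nat.gcd (Finset.univ.gcd fun i => (v i).val) D = 1 ↔ ∃ c : ι → ZMod D, ∑ i, c i * v i = 1 := by
  classical
  constructor
  · intro h
    obtain ⟨c, hc⟩ := zmod_bezout D Finset.univ v
    obtain ⟨u, hu⟩ := ((ZMod.isUnit_iff_coprime _ D).mpr h).exists_left_inv
    refine ⟨fun i => u * c i, ?_⟩
    rw [← hu, ← hc, Finset.mul_sum]
    exact Finset.sum_congr rfl fun i _ => by ring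
  · rintro ⟨c, hc⟩
    by_contra h
    obtain ⟨p, hp, hpd⟩ := Nat.exists_prime_and_dvd h
    have hpD := hpd.trans (Nat.gcd_dvd_right _ _)
    have hpg := hpd.trans (Nat.gcd_dvd_left _ _)
    have : Fact p.Prime := ⟨hp⟩
    have h1 := congrArg (ZMod.castHom hpD (ZMod p)) hc
    rw [map_sum, map_one, Finset.sum_eq_zero] at h1
    · exact zero_ne_one h1
    · intro i _
      rw [map_mul]
      have : p ∣ (v i).val := hpg.trans (Finset.gcd_dvd (Finset.mem_univ i))
      have h2 : ZMod.castHom hpD (ZMod p) (v i) = 0 := by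
        rw [← ZMod.natCast_zmod_val (v i), map_natCast]
        exact (ZMod.natCast_eq_zero_iff _ _).mpr this
      rw [h2, mul_zero]

theorem card_unimod (D n : ℕ) [NeZero D] :
    Nat.card {v // ∃ w, stdB (ZMod D) n v w = 1} = phiN (2 * n) D := by
  rw [phiN]
  let e : Fin n ⊕ Fin n ≃ Fin (2 * n) := finSumFinEquiv.trans (finCongr (two_mul n).symm)
  refine Nat.card_congr ((Equiv.arrowCongr e (Equiv.refl _)).subtypeEquiv fun v => ?_)
  rw [zmod_unimod]
  have h1 : (∃ c : Fin (2 * n) → ZMod D,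
      ∑ i, c i * (Equiv.arrowCongr e (Equiv.refl _)) v i = 1) ↔
      ∃ c : Fin n ⊕ Fin n → ZMod D, ∑ i, c i * v i = 1 := by
    constructor
    · rintro ⟨c, hc⟩
      refine ⟨c ∘ e, ?_⟩
      rw [← hc, ← e.sum_comp]
      simp
    · rintro ⟨c, hc⟩
      refine ⟨c ∘ e.symm, ?_⟩
      rw [← hc, ← e.sum_comp]
      simp
  rw [h1]
  constructor
  · rintro ⟨w, hw⟩
    refine ⟨Sum.elim (fun i => w (.inr i)) (fun i => - w (.inl i)), ?_⟩
    rw [← hw, stdB_apply, Fintype.sum_sum_type, ← Finset.sum_add_distrib]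
    exact Finset.sum_congr rfl fun i _ => by simp; ring
  · rintro ⟨c, hc⟩
    refine ⟨Sum.elim (fun i => - c (.inr i)) (fun i => c (.inl i)), ?_⟩
    rw [← hc, stdB_apply, Fintype.sum_sum_type, ← Finset.sum_add_distrib]
    exact Finset.sum_congr rfl fun i _ => by simp; ring

theorem card_IsoG_zmod (D n : ℕ) [NeZero D] :
    Nat.card (IsoG (stdB (ZMod D) n)) = D ^ (n ^ 2) * ∏ k ∈ Finset.Icc 1 n, phiN (2 * k) D := by
  induction n with
  | zero =>
    have : Subsingleton (IsoG (stdB (ZMod D) 0)) := by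
      refine ⟨fun a b => Subtype.ext (LinearEquiv.ext fun x => Subsingleton.elim _ _)⟩
    simp [Nat.card_eq_of_bijective, Nat.card_unique]
  | succ n ih =>
    have h := card_step (zmod_rcond D) n
    rw [card_unimod, ih, Nat.card_zmod] at h
    apply Nat.eq_of_mul_eq_mul_right (NeZero.pos D)
    rw [h, Finset.prod_Icc_succ_top (by omega)]
    ring

end ZModPart

/-- Cardinality of the symplectic group over `ZMod D`:
`#Sp(D, n) = D^{n²} ∏_{k=1}^n φ_{2k}(D)`. -/
theorem stmt13 (D n : ℕ) (hD : 2 ≤ D) :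
    Nat.card {M : Matrix (Fin n ⊕ Fin n) (Fin n ⊕ Fin n) (ZMod D) //
        Mᵀ * Matrix.fromBlocks 0 1 (-1) 0 * M = Matrix.fromBlocks 0 1 (-1) 0}
      = D ^ (n ^ 2) * ∏ k ∈ Finset.Icc 1 n, phiN (2 * k) D := by
  have : NeZero D := ⟨by omega⟩
  rw [card_matrix, card_IsoG_zmod]
end

section
/- Let u_1, ..., u_r, v_1, ..., v_s ∈ (Z/DZ)^{2n} (s ≤ r ≤ n) be a linearly independent family satisfying the canonical symplectic relations u_i^T Ω u_j = 0, v_i^T Ω v_j = 0, and u_i^T Ω v_j = δ_{ij} (where defined). If r < n, then there exist exactly D^{r−s} · φ_{2(n−r)}(D) vectors u ∈ (Z/DZ)^{2n} such that the extended family u_1, ..., u_r, u, v_1, ..., v_s remains linearly independent and satisfies the canonical relations (with u playing the role of u_{r+1}). -/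
open Matrix

/-- The standard symplectic matrix `Ω = [[0, I], [-I, 0]]` over `ZMod D`. -/
def Om (D n : ℕ) : Matrix (Fin n ⊕ Fin n) (Fin n ⊕ Fin n) (ZMod D) :=
  Matrix.fromBlocks 0 1 (-1) 0

lemma sum_char_vec {D : ℕ} [NeZero D] {κ : Type*} [Fintype κ] [DecidableEq κ] (z : κ → ZMod D) :
    ∑ y : κ → ZMod D, ZMod.stdAddChar (y ⬝ᵥ z) =
      if z = 0 then ((D : ℂ) ^ Fintype.card κ) else 0 := by
  have h1 : ∀ y : κ → ZMod D, ZMod.stdAddChar (y ⬝ᵥ z) = ∏ i, ZMod.stdAddChar (y i * z i) := by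
    intro y
    have : ∀ t : Finset κ, (ZMod.stdAddChar (∑ i ∈ t, y i * z i) : ℂ) =
        ∏ i ∈ t, ZMod.stdAddChar (y i * z i) := by
      intro t
      induction t using Finset.induction_on with
      | empty => simp
      | insert a t ha ih => rw [Finset.sum_insert ha, Finset.prod_insert ha,
          AddChar.map_add_eq_mul, ih]
    exact this Finset.univ
  simp_rw [h1]
  have h2 := Finset.prod_univ_sum (fun _ : κ => (Finset.univ : Finset (ZMod D)))
    (fun i x => (ZMod.stdAddChar (x * z i) : ℂ))
  rw [Fintype.piFinset_univ] at h2
  rw [← h2]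
  simp_rw [AddChar.sum_mulShift _ (ZMod.isPrimitive_stdAddChar D)]
  split_ifs with h
  · subst h; simp [ZMod.card]
  · obtain ⟨i, hi⟩ := Function.ne_iff.mp h
    apply Finset.prod_eq_zero (Finset.mem_univ i)
    simp at hi
    simp [hi]

lemma surj_of_indep {D : ℕ} [NeZero D] {ι κ : Type*} [Fintype ι] [DecidableEq ι] [Fintype κ]
    [DecidableEq κ] (x : ι → κ → ZMod D)
    (h : ∀ a : ι → ZMod D, ∑ i, a i • x i = 0 → a = 0) (b : ι → ZMod D) :
    ∃ y : κ → ZMod D, ∀ i, x i ⬝ᵥ y = b i := by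
  by_contra! hc
  have hD : (D : ℂ) ≠ 0 := Nat.cast_ne_zero.mpr (NeZero.ne D)
  have e1 : ∑ y : κ → ZMod D, ∑ a : ι → ZMod D,
      (ZMod.stdAddChar (a ⬝ᵥ fun i => x i ⬝ᵥ y - b i) : ℂ) = 0 := by
    apply Finset.sum_eq_zero
    intro y _
    rw [sum_char_vec, if_neg]
    intro h0
    obtain ⟨i, hi⟩ := hc y
    exact hi (sub_eq_zero.mp (congrFun h0 i))
  rw [Finset.sum_comm] at e1
  have e2 : ∀ a : ι → ZMod D, ∑ y : κ → ZMod D,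
      (ZMod.stdAddChar (a ⬝ᵥ fun i => x i ⬝ᵥ y - b i) : ℂ) =
      if a = 0 then (D : ℂ) ^ Fintype.card κ else 0 := by
    intro a
    have : ∀ y : κ → ZMod D, (ZMod.stdAddChar (a ⬝ᵥ fun i => x i ⬝ᵥ y - b i) : ℂ) =
        ZMod.stdAddChar (- (a ⬝ᵥ b)) * ZMod.stdAddChar (y ⬝ᵥ ∑ i, a i • x i) := by
      intro y
      rw [← AddChar.map_add_eq_mul]
      congr 1
      rw [dotProduct_sum]
      simp only [dotProduct_comm y, smul_dotProduct]
      simp only [dotProduct.eq_1 a, mul_sub, Finset.sum_sub_distrib, smul_eq_mul]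
      ring
    simp_rw [this]
    rw [← Finset.mul_sum, sum_char_vec]
    by_cases ha : a = 0
    · subst ha; simp
    · rw [if_neg ha, if_neg (fun h0 => ha (h a h0)), mul_zero]
  simp_rw [e2] at e1
  simp [NeZero.ne D] at e1

lemma card_tors_eq {A : Type*} [AddCommGroup A] [Fintype A] (d : ℕ) (hd : 0 < d) :
    Nat.card {a : A // d • a = 0} =
      ∑ e ∈ d.divisors, Nat.card {a : A // addOrderOf a = e} := by
  classical
  simp_rw [Nat.card_eq_fintype_card, Fintype.card_subtype]
  rw [Finset.card_eq_sum_card_fiberwise (f := addOrderOf) (t := d.divisors)]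
  · apply Finset.sum_congr rfl
    intro e he
    congr 1
    ext a
    simp only [Finset.mem_filter, Finset.mem_univ, true_and]
    constructor
    · exact fun h => h.2
    · intro h
      exact ⟨addOrderOf_dvd_iff_nsmul_eq_zero.mp (h ▸ Nat.dvd_of_mem_divisors he), h⟩
  · intro a ha
    simp at ha ⊢
    exact ⟨addOrderOf_dvd_iff_nsmul_eq_zero.mpr ha, hd.ne'⟩

lemma card_order_eq {A B X : Type*} [AddCommGroup A] [AddCommGroup B] [AddCommGroup X]
    [Fintype A] [Fintype B] [Fintype X] (e : X × A ≃+ X × B) (d : ℕ) (hd : 0 < d) :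
    Nat.card {a : A // addOrderOf a = d} = Nat.card {b : B // addOrderOf b = d} := by
  classical
  have hT : ∀ d : ℕ, Nat.card {a : A // d • a = 0} = Nat.card {b : B // d • b = 0} := by
    intro d
    have hp : ∀ (C : Type _) [AddCommGroup C], Nat.card {c : X × C // d • c = 0} =
        Nat.card {x : X // d • x = 0} * Nat.card {c : C // d • c = 0} := by
      intro C _
      rw [← Nat.card_prod]
      exact Nat.card_congr ((Equiv.subtypeEquivRight (fun c => by
        simp [Prod.ext_iff])).trans (Equiv.subtypeProdEquivProd (p := fun x : X => d • x = 0)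
          (q := fun c : C => d • c = 0)))
    have hp' : ∀ (C : Type _) [AddCommGroup C], Nat.card {c : X × C // d • c = 0} =
        Nat.card {x : X // d • x = 0} * Nat.card {c : C // d • c = 0} := by
      intro C _
      rw [← Nat.card_prod]
      exact Nat.card_congr ((Equiv.subtypeEquivRight (fun c => by
        simp [Prod.ext_iff])).trans (Equiv.subtypeProdEquivProd (p := fun x : X => d • x = 0)
          (q := fun c : C => d • c = 0)))
    have h1 : Nat.card {c : X × A // d • c = 0} = Nat.card {c : X × B // d • c = 0} :=
      Nat.card_congr (e.toEquiv.subtypeEquiv (fun c => by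
        have : d • e c = e (d • c) := (map_nsmul e d c).symm
        change d • c = 0 ↔ d • e c = 0
        rw [this]
        exact (map_eq_zero_iff e e.injective).symm))
    rw [hp A, hp' B] at h1
    have : Nonempty {x : X // d • x = 0} := ⟨⟨0, by simp⟩⟩
    exact Nat.eq_of_mul_eq_mul_left Nat.card_pos h1
  induction d using Nat.strong_induction_on with
  | _ d ih =>
    have h := hT d
    rw [card_tors_eq d hd, card_tors_eq d hd, ← Nat.insert_self_properDivisors hd.ne',
      Finset.sum_insert Nat.self_notMem_properDivisors,
      Finset.sum_insert Nat.self_notMem_properDivisors] at h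
    have h2 : ∑ e ∈ d.properDivisors, Nat.card {a : A // addOrderOf a = e} =
        ∑ e ∈ d.properDivisors, Nat.card {a : B // addOrderOf a = e} := by
      apply Finset.sum_congr rfl
      intro k hk
      exact ih k (Nat.mem_properDivisors.mp hk).2 (Nat.pos_of_mem_properDivisors hk)
    omega

lemma order_iff {D : ℕ} [NeZero D] {A : Type*} [AddCommGroup A] [Module (ZMod D) A] (x : A) :
    addOrderOf x = D ↔ ∀ c : ZMod D, c • x = 0 → c = 0 := by
  have hk : ∀ k : ℕ, k • x = (k : ZMod D) • x := fun k => (Nat.cast_smul_eq_nsmul _ _ _).symm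
  constructor
  · intro h c hc
    rw [← ZMod.natCast_zmod_val c, ← hk, ← addOrderOf_dvd_iff_nsmul_eq_zero, h] at hc
    rw [← ZMod.natCast_zmod_val c]
    exact (ZMod.natCast_eq_zero_iff _ _).mpr hc
  · intro h
    apply Nat.dvd_antisymm
    · rw [addOrderOf_dvd_iff_nsmul_eq_zero, hk]; simp
    · rw [← ZMod.natCast_eq_zero_iff]
      apply h
      rw [← hk, addOrderOf_nsmul_eq_zero]

lemma phi_iff {D m : ℕ} [NeZero D] (x : Fin m → ZMod D) :
    Nat.gcd (Finset.univ.gcd fun i => (x i).val) D = 1 ↔ addOrderOf x = D := by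
  rw [order_iff]
  have key : ∀ k : ℕ, (k : ZMod D) • x = 0 ↔ ∀ i, D ∣ k * (x i).val := by
    intro k
    rw [funext_iff]
    apply forall_congr'
    intro i
    rw [← ZMod.natCast_eq_zero_iff]
    simp
  constructor
  · intro h c hc
    rw [← ZMod.natCast_zmod_val c, key] at hc
    rw [← ZMod.natCast_zmod_val c, ZMod.natCast_eq_zero_iff]
    have h1 : D ∣ Finset.univ.gcd fun i => c.val * (x i).val :=
      Finset.dvd_gcd fun i _ => hc i
    rw [Finset.gcd_mul_left] at h1
    simp only [normalize_eq] at h1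
    exact (Nat.Coprime.symm h).dvd_of_dvd_mul_right h1
  · intro h
    set g := Nat.gcd (Finset.univ.gcd fun i => (x i).val) D with hg
    have hgD : g ∣ D := Nat.gcd_dvd_right _ _
    have h1 := h ((D / g : ℕ) : ZMod D) ((key _).mpr (by
      intro i
      have : g ∣ (x i).val := (Nat.gcd_dvd_left _ _).trans (Finset.gcd_dvd (Finset.mem_univ i))
      obtain ⟨t, ht⟩ := this
      rw [ht, ← mul_assoc, Nat.div_mul_cancel hgD]
      exact dvd_mul_right _ _))
    rw [ZMod.natCast_eq_zero_iff] at h1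
    have hDpos : 0 < D := Nat.pos_of_ne_zero (NeZero.ne D)
    have hpos : 0 < D / g := Nat.div_pos (Nat.le_of_dvd hDpos hgD) (Nat.pos_of_dvd_of_pos hgD hDpos)
    have h2 := Nat.le_of_dvd hpos h1
    have h3 : D / g * g = D := Nat.div_mul_cancel hgD
    nlinarith [Nat.pos_of_dvd_of_pos hgD hDpos]

lemma phiN_eq {D m : ℕ} [NeZero D] :
    phiN m D = Nat.card {x : Fin m → ZMod D // addOrderOf x = D} :=
  Nat.card_congr (Equiv.subtypeEquivRight phi_iff)

section SymplecticCount

variable {D : ℕ} {M : Type*} [AddCommGroup M] [Module (ZMod D) M]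

/-- The common orthogonal complement of two families. -/
def orthW (B : LinearMap.BilinForm (ZMod D) M) {r : ℕ} (u v : Fin r → M) :
    Submodule (ZMod D) M where
  carrier := {w | ∀ i, B (u i) w = 0 ∧ B (v i) w = 0}
  zero_mem' := by simp
  add_mem' := by
    intro a b ha hb i
    simp [ha i, hb i]
  smul_mem' := by
    intro c a ha i
    simp [ha i]

lemma mem_orthW (B : LinearMap.BilinForm (ZMod D) M) {r : ℕ} (u v : Fin r → M) (w : M) :
    w ∈ orthW B u v ↔ ∀ i, B (u i) w = 0 ∧ B (v i) w = 0 := Iff.rfl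

variable (B : LinearMap.BilinForm (ZMod D) M) (hB : ∀ x y, B x y = - B y x)
  {r : ℕ} (u v : Fin r → M) (huu : ∀ i j, B (u i) (u j) = 0) (hvv : ∀ i j, B (v i) (v j) = 0)
  (huv : ∀ i j, B (u i) (v j) = if i = j then 1 else 0)

/-- Splitting off a hyperbolic part. -/
noncomputable def splitEquiv (hB : ∀ x y, B x y = - B y x)
    (huu : ∀ i j, B (u i) (u j) = 0) (hvv : ∀ i j, B (v i) (v j) = 0)
    (huv : ∀ i j, B (u i) (v j) = if i = j then 1 else 0) :
    (((Fin r → ZMod D) × (Fin r → ZMod D)) × orthW B u v) ≃+ M where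
  toFun p := ∑ i, p.1.1 i • u i + ∑ i, p.1.2 i • v i + (p.2 : M)
  invFun x := ((fun i => B x (v i), fun i => B (u i) x),
    ⟨x - (∑ i, B x (v i) • u i + ∑ i, B (u i) x • v i), by
      intro i
      have h := fun j => hB (v i) (u j)
      constructor
      · simp [huu, huv]
      · simp [h, hvv, huv, hB x (v i)]⟩)
  left_inv := by
    rintro ⟨⟨a, b⟩, ⟨w, hw⟩⟩
    have hvu : ∀ i j, B (v i) (u j) = if j = i then -1 else 0 := by
      intro i j; rw [hB, huv]; split_ifs <;> simp
    have h1 : ∀ i, B (∑ i, a i • u i + ∑ i, b i • v i + w) (v i) = a i := by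
      intro i
      simp [huv, hvv, hB w (v i), (hw i).2]
    have h2 : ∀ i, B (u i) (∑ i, a i • u i + ∑ i, b i • v i + w) = b i := by
      intro i
      simp [huv, huu, (hw i).1]
    ext i
    · exact h1 i
    · exact h2 i
    · simp only [h1, h2]
      abel
  right_inv := by
    intro x
    simp
  map_add' := by
    intro p q
    simp [add_smul, Finset.sum_add_distrib]
    abel

/-- Coordinates on the set of admissible vectors. -/
noncomputable def admEquiv (hB : ∀ x y, B x y = - B y x)
    (huu : ∀ i j, B (u i) (u j) = 0)
    (huv : ∀ i j, B (u i) (v j) = if i = j then 1 else 0) (s : ℕ) (P : M → Prop) :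
    {w : M // (∀ i, B (u i) w = 0) ∧ (∀ i : Fin r, (i : ℕ) < s → B w (v i) = 0) ∧
      P (w - ∑ i, B w (v i) • u i)} ≃
    ({i : Fin r // s ≤ (i : ℕ)} → ZMod D) × {x : orthW B u v // P (x : M)} where
  toFun w := (fun i => B w.1 (v i.1), ⟨⟨w.1 - ∑ i, B w.1 (v i) • u i, by
    intro i
    have h := fun j => hB (v i) (u j)
    constructor
    · simp [huu, w.2.1 i]
    · simp [h, huv, hB w.1 (v i)]⟩, w.2.2.2⟩)
  invFun p := ⟨p.2.1.1 + ∑ i : Fin r, (if h : s ≤ (i : ℕ) then p.1 ⟨i, h⟩ else 0) • u i, by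
    obtain ⟨a, ⟨⟨w, hw⟩, hP⟩⟩ := p
    dsimp only at hP ⊢
    have key : ∀ j, B (w + ∑ i : Fin r, (if h : s ≤ (i : ℕ) then a ⟨i, h⟩ else 0) • u i) (v j)
        = (if h : s ≤ (j : ℕ) then a ⟨j, h⟩ else 0) := by
      intro j
      simp only [map_add, map_sum, map_smul, LinearMap.add_apply, LinearMap.sum_apply,
        LinearMap.smul_apply, huv, hB w (v j), (hw j).2]
      simp
    refine ⟨fun i => ?_, fun i hi => ?_, ?_⟩
    · simp only [map_add, map_sum, map_smul, huu, (hw i).1]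
      simp
    · rw [key, dif_neg (by omega)]
    · simp_rw [key]
      simpa using hP⟩
  left_inv := by
    rintro ⟨w, h1, h2, h3⟩
    ext
    dsimp only
    have : ∀ i : Fin r, (if h : s ≤ (i : ℕ) then B w (v i) else 0) = B w (v i) := by
      intro i
      split_ifs with h
      · rfl
      · exact (h2 i (by omega)).symm
    simp [this]
  right_inv := by
    rintro ⟨a, ⟨⟨w, hw⟩, hP⟩⟩
    have key : ∀ j, B (w + ∑ i : Fin r, (if h : s ≤ (i : ℕ) then a ⟨i, h⟩ else 0) • u i) (v j)
        = (if h : s ≤ (j : ℕ) then a ⟨j, h⟩ else 0) := by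
      intro j
      simp only [map_add, map_sum, map_smul, LinearMap.add_apply, LinearMap.sum_apply,
        LinearMap.smul_apply, huv, hB w (v j), (hw j).2]
      simp
    ext i
    · simp only [key]
      rw [dif_pos i.2]
    · simp only [key]
      simp

/-- Completing a partial symplectic family. -/
lemma complete_family (hB : ∀ x y, B x y = - B y x) (hB0 : ∀ x, B x x = 0) {s : ℕ}
    (y : Fin r → M) (huu : ∀ i j, B (u i) (u j) = 0)
    (huy : ∀ i j, B (u i) (y j) = if i = j then 1 else 0)
    (hyy : ∀ i j : Fin r, (i : ℕ) < s → B (y i) (y j) = 0) :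
    ∃ v' : Fin r → M, (∀ i : Fin r, (i : ℕ) < s → v' i = y i) ∧
      (∀ i j, B (u i) (v' j) = if i = j then 1 else 0) ∧ (∀ i j, B (v' i) (v' j) = 0) := by
  classical
  have hyu : ∀ i j, B (y i) (u j) = if j = i then -1 else 0 := by
    intro i j; rw [hB, huy]; split_ifs <;> simp
  refine ⟨fun j => y j + ∑ k, (if j < k then - B (y j) (y k) else 0) • u k, ?_, ?_, ?_⟩
  · intro i hi
    simp [hyy i _ hi]
  · intro i j
    simp only [map_add, map_sum, map_smul, huu, huy]
    simp
  · intro i j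
    simp only [map_add, map_sum, map_smul, LinearMap.add_apply, LinearMap.sum_apply,
        LinearMap.smul_apply, huu, huy, hyu]
    simp
    rcases lt_trichotomy i j with h | h | h
    · simp [h, h.not_gt]
    · subst h; simp [hB0]
    · simp [h, h.not_gt, hB (y i) (y j)]

end SymplecticCount

lemma adm_iff {D r s : ℕ} {M : Type*} [AddCommGroup M] [Module (ZMod D) M]
    (B : LinearMap.BilinForm (ZMod D) M) (hB : ∀ x y, B x y = - B y x) (hB0 : ∀ x, B x x = 0)
    (hsr : s ≤ r) (u v' : Fin r → M) (v : Fin s → M)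
    (huu : ∀ i j, B (u i) (u j) = 0) (hvv : ∀ i j, B (v' i) (v' j) = 0)
    (huv : ∀ i j, B (u i) (v' j) = if i = j then 1 else 0)
    (hv : ∀ j : Fin s, v j = v' (Fin.castLE hsr j)) (w : M) :
    ((∀ a : Fin (r + 1) ⊕ Fin s → ZMod D,
          ∑ i, a i • Sum.elim (Fin.snoc u w : Fin (r + 1) → M) v i = 0 → a = 0) ∧
        (∀ i j : Fin (r + 1), B ((Fin.snoc u w : Fin (r + 1) → M) i)
          ((Fin.snoc u w : Fin (r + 1) → M) j) = 0) ∧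
        (∀ (i : Fin (r + 1)) (j : Fin s),
          B ((Fin.snoc u w : Fin (r + 1) → M) i) (v j) =
            if (i : ℕ) = (j : ℕ) then 1 else 0)) ↔
    ((∀ i, B (u i) w = 0) ∧ (∀ i : Fin r, (i : ℕ) < s → B w (v' i) = 0) ∧
      ∀ c : ZMod D, c • (w - ∑ i, B w (v' i) • u i) = 0 → c = 0) := by
  constructor
  · rintro ⟨h1, h2, h3⟩
    refine ⟨fun i => ?_, fun i hi => ?_, fun c hc => ?_⟩
    · simpa using h2 i.castSucc (Fin.last r)
    · have h := h3 (Fin.last r) ⟨i, hi⟩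
      rw [hv] at h
      simp only [Fin.snoc_last, Fin.val_last] at h
      rw [if_neg (by omega)] at h
      exact h
    · have h := h1 (Sum.elim (Fin.snoc (fun i => - (c * B w (v' i))) c : Fin (r + 1) → ZMod D) 0)
        (by
          rw [Fintype.sum_sum_type, Fin.sum_univ_castSucc]
          simp only [Sum.elim_inl, Sum.elim_inr, Fin.snoc_castSucc, Fin.snoc_last,
            Pi.zero_apply, zero_smul, Finset.sum_const_zero, add_zero]
          rw [← hc, smul_sub, Finset.smul_sum]
          simp only [neg_smul, mul_smul, Finset.sum_neg_distrib]
          abel)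
      simpa using congrFun h (Sum.inl (Fin.last r))
  · rintro ⟨h1, h2, h3⟩
    have hwu : ∀ i, B w (u i) = 0 := fun i => by rw [hB, h1, neg_zero]
    refine ⟨fun a ha => ?_, fun i j => ?_, fun i j => ?_⟩
    · rw [Fintype.sum_sum_type, Fin.sum_univ_castSucc] at ha
      simp only [Sum.elim_inl, Sum.elim_inr, Fin.snoc_castSucc, Fin.snoc_last] at ha
      have hb : ∀ j : Fin s, a (Sum.inr j) = 0 := by
        intro j
        have h := congrArg (B (u (Fin.castLE hsr j))) ha
        simp only [map_add, map_sum, map_smul, huu, h1, hv, huv, map_zero] at h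
        simpa using h
      simp only [hb, zero_smul, Finset.sum_const_zero, add_zero] at ha
      have hai : ∀ i : Fin r, a (Sum.inl i.castSucc) = - (a (Sum.inl (Fin.last r)) * B w (v' i)) := by
        intro i
        have h := congrArg (fun x => B x (v' i)) ha
        simp only [map_add, map_sum, map_smul, LinearMap.add_apply, LinearMap.sum_apply,
          LinearMap.smul_apply, huv, map_zero, LinearMap.zero_apply] at h
        simp at h
        exact eq_neg_of_add_eq_zero_left h
      have hc : a (Sum.inl (Fin.last r)) = 0 := by
        apply h3
        rw [← ha, smul_sub, Finset.smul_sum]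
        simp only [hai, neg_smul, mul_smul, Finset.sum_neg_distrib]
        abel
      funext k
      rcases k with k | k
      · refine Fin.lastCases ?_ (fun i => ?_) k
        · simpa using hc
        · simp [hai, hc]
      · simpa using hb k
    · refine Fin.lastCases ?_ (fun i => ?_) i <;> refine Fin.lastCases ?_ (fun j => ?_) j <;>
        simp [huu, h1, hwu, hB0]
    · rw [hv]
      refine Fin.lastCases ?_ (fun i => ?_) i
      · simp only [Fin.snoc_last, Fin.val_last]
        rw [h2 _ (by simp), if_neg (by omega)]
      · simp only [Fin.snoc_castSucc, huv, Fin.ext_iff, Fin.val_castSucc, Fin.val_castLE]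

lemma Om_skew (D n : ℕ) (x y : Fin n ⊕ Fin n → ZMod D) :
    x ⬝ᵥ (Om D n).mulVec y = - (y ⬝ᵥ (Om D n).mulVec x) := by
  have hT : (Om D n)ᵀ = - Om D n := by
    simp [Om, Matrix.fromBlocks_transpose, Matrix.fromBlocks_neg]
  rw [dotProduct_mulVec, ← mulVec_transpose, hT, neg_mulVec, neg_dotProduct, dotProduct_comm]

lemma Om_self (D n : ℕ) (x : Fin n ⊕ Fin n → ZMod D) :
    x ⬝ᵥ (Om D n).mulVec x = 0 := by
  simp only [Om, dotProduct, Fintype.sum_sum_type, Matrix.fromBlocks_mulVec]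
  simp [mul_comm, ← Finset.sum_add_distrib, neg_mulVec]

lemma Om_surj (D n : ℕ) (x : Fin n ⊕ Fin n → ZMod D) :
    ∃ y, (Om D n).mulVec y = x := by
  refine ⟨(-(Om D n)).mulVec x, ?_⟩
  have h : Om D n * (- Om D n) = 1 := by
    simp [Om, Matrix.fromBlocks_neg, Matrix.fromBlocks_multiply]
  rw [mulVec_mulVec, h, one_mulVec]

/-- Counting extensions of a canonical symplectic family: if `r < n`, there are
exactly `D^{r-s} · φ_{2(n-r)}(D)` vectors `w` extending the family as `u_{r+1}`
while keeping linear independence and the canonical relations. -/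
theorem stmt15 (D n r s : ℕ) (hD : 2 ≤ D) (hsr : s ≤ r) (hrn : r < n)
    (u : Fin r → Fin n ⊕ Fin n → ZMod D)
    (v : Fin s → Fin n ⊕ Fin n → ZMod D)
    (hli : ∀ a : Fin r ⊕ Fin s → ZMod D,
      ∑ i, a i • Sum.elim u v i = 0 → a = 0)
    (huu : ∀ i j : Fin r, u i ⬝ᵥ (Om D n).mulVec (u j) = 0)
    (hvv : ∀ i j : Fin s, v i ⬝ᵥ (Om D n).mulVec (v j) = 0)
    (huv : ∀ (i : Fin r) (j : Fin s),
      u i ⬝ᵥ (Om D n).mulVec (v j) = if (i : ℕ) = (j : ℕ) then 1 else 0) :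
    Nat.card {w : Fin n ⊕ Fin n → ZMod D //
        letI u' : Fin (r + 1) → Fin n ⊕ Fin n → ZMod D := Fin.snoc u w
        (∀ a : Fin (r + 1) ⊕ Fin s → ZMod D,
          ∑ i, a i • Sum.elim u' v i = 0 → a = 0) ∧
        (∀ i j : Fin (r + 1), u' i ⬝ᵥ (Om D n).mulVec (u' j) = 0) ∧
        (∀ (i : Fin (r + 1)) (j : Fin s),
          u' i ⬝ᵥ (Om D n).mulVec (v j) =
            if (i : ℕ) = (j : ℕ) then 1 else 0)}
      = D ^ (r - s) * phiN (2 * (n - r)) D := by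
  have : NeZero D := ⟨by omega⟩
  classical
  set B : LinearMap.BilinForm (ZMod D) (Fin n ⊕ Fin n → ZMod D) := Matrix.toBilin' (Om D n)
    with hBdef
  have hBa : ∀ x y, x ⬝ᵥ (Om D n).mulVec y = B x y := fun x y =>
    (Matrix.toBilin'_apply' _ _ _).symm
  have hB : ∀ x y, B x y = - B y x := fun x y => by
    rw [← hBa, ← hBa, Om_skew]
  have hB0 : ∀ x, B x x = 0 := fun x => by rw [← hBa, Om_self]
  simp only [hBa] at huu hvv huv ⊢
  have hex : ∀ j : Fin r, ∃ y, (∀ i, B (u i) y = if i = j then 1 else 0) ∧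
      (∀ i, B (v i) y = 0) ∧ (∀ h : (j : ℕ) < s, y = v ⟨j, h⟩) := by
    intro j
    by_cases hj : (j : ℕ) < s
    · refine ⟨v ⟨j, hj⟩, fun i => ?_, fun i => hvv _ _, fun _ => rfl⟩
      rw [huv]; simp [Fin.ext_iff]
    · obtain ⟨z, hz⟩ := surj_of_indep (Sum.elim u v) hli
        (Sum.elim (fun i => if i = j then 1 else 0) (fun _ => 0))
      obtain ⟨y, rfl⟩ := Om_surj D n z
      refine ⟨y, fun i => ?_, fun i => ?_, fun h => absurd h hj⟩
      · simpa [hBa] using hz (Sum.inl i)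
      · simpa [hBa] using hz (Sum.inr i)
  choose y hy1 hy2 hy3 using hex
  obtain ⟨v', hv1, huv', hvv'⟩ := complete_family B u hB hB0 (s := s) y huu
    (fun i j => hy1 j i) (fun i j hi => by rw [hy3 i hi]; exact hy2 j _)
  have hv : ∀ j : Fin s, v j = v' (Fin.castLE hsr j) := by
    intro j
    rw [hv1 _ (by simp), hy3 _ (by simp)]
    rfl
  rw [Nat.card_congr (Equiv.subtypeEquivRight
    (adm_iff B hB hB0 hsr u v' v huu hvv' huv' hv))]
  rw [Nat.card_congr (admEquiv B u v' hB huu huv' s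
    (fun x => ∀ c : ZMod D, c • x = 0 → c = 0)), Nat.card_prod]
  congr 1
  · rw [Nat.card_fun, Nat.card_zmod, Nat.card_eq_fintype_card]
    congr 1
    have h1 := Fintype.card_subtype_compl (fun i : Fin r => (i : ℕ) < s)
    have h2 : Fintype.card {i : Fin r // (i : ℕ) < s} = s := by
      rw [Fintype.card_congr (Fin.castLEquiv hsr).symm, Fintype.card_fin]
    simp only [not_lt] at h1
    rw [h1, h2, Fintype.card_fin]
  · rw [phiN_eq]
    have hcard : Fintype.card (Fin n ⊕ Fin n) =
        Fintype.card ((Fin r ⊕ Fin r) ⊕ Fin (2 * (n - r))) := by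
      simp; omega
    let e0 : (Fin n ⊕ Fin n) ≃ (Fin r ⊕ Fin r) ⊕ Fin (2 * (n - r)) :=
      Fintype.equivOfCardEq hcard
    let e1 : (Fin n ⊕ Fin n → ZMod D) ≃+
        ((Fin r → ZMod D) × (Fin r → ZMod D)) × (Fin (2 * (n - r)) → ZMod D) :=
      ((LinearEquiv.funCongrLeft (ZMod D) (ZMod D) e0.symm).trans
        ((LinearEquiv.sumArrowLequivProdArrow _ _ (ZMod D) (ZMod D)).trans
          (LinearEquiv.prodCongr (LinearEquiv.sumArrowLequivProdArrow _ _ (ZMod D) (ZMod D))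
            (LinearEquiv.refl _ _)))).toAddEquiv
    have : Fintype (orthW B u v') := Fintype.ofFinite _
    rw [← card_order_eq ((splitEquiv B u v' hB huu hvv' huv').trans e1) D (by omega)]
    apply Nat.card_congr
    apply Equiv.subtypeEquivRight
    intro x
    rw [order_iff]
    simp [Subtype.ext_iff]
end
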